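/- arXiv:1204.5220 — 2 statements merged into one kernel-verified Lean document; each statement's English description precedes it below -/
import Mathlib

section
/- Let p > 0, λ > 0 and f ∈ ℝ^m, and write |u − f|_p^p := Σ_{i=1}^m |u_i − f_i|^p. Then as ε → 0 the functionals f_ε + λ|· − f|_p^p Γ-converge (with respect to Euclidean convergence on ℝ^m) to f₀ + λ|· − f|_p^p, and if W satisfies (W2) then compactness holds: for ε_n → 0⁺ and any sequence u_n with f_{ε_n}(u_n) + λ|u_n − f|_p^p uniformly bounded there is a subsequence converging to some u_∞ ∈ V^b. Moreover, if instead for a fixed M > 0 such that mM is an integer between 0 and m the domain of f_ε is restricted to V^M := {u ∈ ℝ^m : Σ_{i=1}^m u_i = mM}, then f_ε Γ-converges on V^M to the restriction of f₀ to V^M, and the compactness conclusion (with limit in V^b ∩ V^M) remains valid. -/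
open MeasureTheory Filter Topology ENNReal
open scoped Classical

noncomputable section

/-- The graph Ginzburg–Landau functional
`f_ε(u) = χ Σ_{i,j} ω_{ij} (u_i - u_j)² + ε⁻¹ Σ_i W(u_i)`. -/
def graphGL (m : ℕ) (ω : Fin m → Fin m → ℝ) (χ : ℝ) (W : ℝ → ℝ) (ε : ℝ)
    (u : Fin m → ℝ) : ℝ :=
  χ * ∑ i, ∑ j, ω i j * (u i - u j) ^ 2 + ε⁻¹ * ∑ i, W (u i)

/-- The limit functional `f₀(u) = χ Σ_{i,j} ω_{ij} |u_i - u_j|` on binary functions,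
`+∞` otherwise. -/
def graphGL0 (m : ℕ) (ω : Fin m → Fin m → ℝ) (χ : ℝ) (u : Fin m → ℝ) : ℝ≥0∞ :=
  if ∀ i, u i = 0 ∨ u i = 1 then ENNReal.ofReal (χ * ∑ i, ∑ j, ω i j * |u i - u j|) else ⊤

/-- The fidelity term `|u - f|_p^p = Σ_i |u_i - f_i|^p`. -/
def fidelity (m : ℕ) (p : ℝ) (f u : Fin m → ℝ) : ℝ := ∑ i, |u i - f i| ^ p

/-- The Dirichlet part of `graphGL` is bounded by the whole functional. -/
lemma dirichlet_le_graphGL {m : ℕ} {ω : Fin m → Fin m → ℝ} {χ : ℝ} {W : ℝ → ℝ}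
    (hWnn : ∀ s, 0 ≤ W s) {ε : ℝ} (hε : 0 < ε) (u : Fin m → ℝ) :
    χ * ∑ i, ∑ j, ω i j * (u i - u j) ^ 2 ≤ graphGL m ω χ W ε u := by
  have h : 0 ≤ ε⁻¹ * ∑ i, W (u i) :=
    mul_nonneg (inv_nonneg.2 hε.le) (Finset.sum_nonneg fun i _ => hWnn _)
  unfold graphGL
  linarith

/-- Each single potential term is bounded by `graphGL`. -/
lemma inv_mul_potential_le_graphGL {m : ℕ} {ω : Fin m → Fin m → ℝ}
    (hωnn : ∀ i j, 0 ≤ ω i j) {χ : ℝ} (hχ : 0 < χ) {W : ℝ → ℝ} (hWnn : ∀ s, 0 ≤ W s)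
    {ε : ℝ} (hε : 0 < ε) (u : Fin m → ℝ) (i : Fin m) :
    ε⁻¹ * W (u i) ≤ graphGL m ω χ W ε u := by
  have h₁ : 0 ≤ χ * ∑ i, ∑ j, ω i j * (u i - u j) ^ 2 :=
    mul_nonneg hχ.le (Finset.sum_nonneg fun i _ => Finset.sum_nonneg fun j _ =>
      mul_nonneg (hωnn i j) (sq_nonneg _))
  have h₂ : W (u i) ≤ ∑ i, W (u i) :=
    Finset.single_le_sum (f := fun i => W (u i)) (fun i _ => hWnn _) (Finset.mem_univ i)
  have h₃ := mul_le_mul_of_nonneg_left h₂ (inv_nonneg.2 hε.le)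
  unfold graphGL
  linarith

/-- On binary functions the squared and the absolute differences coincide. -/
lemma dirichlet_eq_of_binary {m : ℕ} (ω : Fin m → Fin m → ℝ) {u : Fin m → ℝ}
    (hu : ∀ i, u i = 0 ∨ u i = 1) :
    ∑ i, ∑ j, ω i j * |u i - u j| = ∑ i, ∑ j, ω i j * (u i - u j) ^ 2 := by
  refine Finset.sum_congr rfl fun i _ => Finset.sum_congr rfl fun j _ => ?_
  rcases hu i with hi | hi <;> rcases hu j with hj | hj <;> simp [hi, hj]

/-- Lower bound for `graphGL` perturbed by a continuous nonnegative term. -/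
lemma graphGL0_add_le_liminf {m : ℕ} {ω : Fin m → Fin m → ℝ} (hωnn : ∀ i j, 0 ≤ ω i j)
    {χ : ℝ} (hχ : 0 < χ) {W : ℝ → ℝ} (hW : Continuous W) (hWnn : ∀ s, 0 ≤ W s)
    (hWzero : ∀ s, W s = 0 ↔ s = 0 ∨ s = 1)
    {g : (Fin m → ℝ) → ℝ} (hg : Continuous g) (hgnn : ∀ u, 0 ≤ g u)
    {e : ℕ → ℝ} (hepos : ∀ n, 0 < e n) (helim : Tendsto e atTop (𝓝 0))
    {u : Fin m → ℝ} {U : ℕ → Fin m → ℝ} (hU : Tendsto U atTop (𝓝 u)) :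
    graphGL0 m ω χ u + ENNReal.ofReal (g u) ≤
      liminf (fun n => ENNReal.ofReal (graphGL m ω χ W (e n) (U n) + g (U n))) atTop := by
  by_cases hu : ∀ i, u i = 0 ∨ u i = 1
  · have hD : 0 ≤ χ * ∑ i, ∑ j, ω i j * |u i - u j| :=
      mul_nonneg hχ.le (Finset.sum_nonneg fun i _ => Finset.sum_nonneg fun j _ =>
        mul_nonneg (hωnn i j) (abs_nonneg _))
    rw [graphGL0, if_pos hu, ← ENNReal.ofReal_add hD (hgnn u), dirichlet_eq_of_binary ω hu]
    have hcont : Continuous fun v : Fin m → ℝ =>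
        ENNReal.ofReal (χ * ∑ i, ∑ j, ω i j * (v i - v j) ^ 2 + g v) :=
      ENNReal.continuous_ofReal.comp (by fun_prop)
    rw [← ((hcont.tendsto u).comp hU).liminf_eq]
    refine liminf_le_liminf (Eventually.of_forall fun n => ?_)
    exact ENNReal.ofReal_le_ofReal
      (add_le_add (dirichlet_le_graphGL hWnn (hepos n) (U n)) le_rfl)
  · obtain ⟨i, hi⟩ := not_forall.1 hu
    have hpos : 0 < W (u i) := (hWnn _).lt_of_ne fun h => hi ((hWzero _).1 h.symm)
    have hinv : Tendsto (fun n => (e n)⁻¹) atTop atTop :=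
      (tendsto_nhdsWithin_iff.2 ⟨helim, Eventually.of_forall hepos⟩).inv_tendsto_nhdsGT_zero
    have hWU : Tendsto (fun n => W (U n i)) atTop (𝓝 (W (u i))) :=
      (hW.tendsto _).comp (tendsto_pi_nhds.1 hU i)
    have htop : Tendsto (fun n => graphGL m ω χ W (e n) (U n) + g (U n)) atTop atTop := by
      refine tendsto_atTop_mono (fun n => ?_) (hinv.atTop_mul_pos hpos hWU)
      have := inv_mul_potential_le_graphGL hωnn hχ hWnn (hepos n) (U n) i
      have := hgnn (U n)
      linarith
    exact le_top.trans_eq (ENNReal.tendsto_ofReal_atTop.comp htop).liminf_eq.symm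

/-- The constant sequence is a recovery sequence. -/
lemma limsup_const_le_graphGL0_add {m : ℕ} (ω : Fin m → Fin m → ℝ)
    (hωnn : ∀ i j, 0 ≤ ω i j) {χ : ℝ} (hχ : 0 < χ) {W : ℝ → ℝ}
    (hWzero : ∀ s, W s = 0 ↔ s = 0 ∨ s = 1)
    {g : (Fin m → ℝ) → ℝ} (hgnn : ∀ u, 0 ≤ g u) (e : ℕ → ℝ) (u : Fin m → ℝ) :
    limsup (fun n => ENNReal.ofReal (graphGL m ω χ W (e n) u + g u)) atTop ≤
      graphGL0 m ω χ u + ENNReal.ofReal (g u) := by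
  by_cases hu : ∀ i, u i = 0 ∨ u i = 1
  · have hD : 0 ≤ χ * ∑ i, ∑ j, ω i j * |u i - u j| :=
      mul_nonneg hχ.le (Finset.sum_nonneg fun i _ => Finset.sum_nonneg fun j _ =>
        mul_nonneg (hωnn i j) (abs_nonneg _))
    have hWu : ∑ i, W (u i) = 0 := Finset.sum_eq_zero fun i _ => (hWzero _).2 (hu i)
    rw [graphGL0, if_pos hu, ← ENNReal.ofReal_add hD (hgnn u), dirichlet_eq_of_binary ω hu]
    simp [graphGL, hWu]
  · simp [graphGL0, hu]

/-- Sequences of bounded energy have a subsequence converging to a binary function, provided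
the potential grows quadratically. -/
lemma exists_subseq_tendsto_binary {m : ℕ} {ω : Fin m → Fin m → ℝ}
    (hωnn : ∀ i j, 0 ≤ ω i j) {χ : ℝ} (hχ : 0 < χ) {W : ℝ → ℝ} (hW : Continuous W)
    (hWnn : ∀ s, 0 ≤ W s) (hWzero : ∀ s, W s = 0 ↔ s = 0 ∨ s = 1)
    {e : ℕ → ℝ} (hepos : ∀ n, 0 < e n) (helim : Tendsto e atTop (𝓝 0))
    (hW2 : ∃ c > (0:ℝ), ∃ R : ℝ, ∀ s : ℝ, R ≤ |s| → c * (s ^ 2 - 1) ≤ W s)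
    {U : ℕ → Fin m → ℝ} {C : ℝ} (hC : 0 < C)
    (hUC : ∀ n, graphGL m ω χ W (e n) (U n) ≤ C) :
    ∃ φ : ℕ → ℕ, StrictMono φ ∧ ∃ uinf : Fin m → ℝ,
      (∀ i, uinf i = 0 ∨ uinf i = 1) ∧ Tendsto (U ∘ φ) atTop (𝓝 uinf) := by
  obtain ⟨c, hc, R, hR⟩ := hW2
  have hWle : ∀ n i, W (U n i) ≤ e n * C := fun n i =>
    (inv_mul_le_iff₀ (hepos n)).1
      ((inv_mul_potential_le_graphGL hωnn hχ hWnn (hepos n) (U n) i).trans (hUC n))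
  obtain ⟨E, hE⟩ := helim.bddAbove_range
  have hEn : ∀ n, e n ≤ E := fun n => hE ⟨n, rfl⟩
  have hE0 : 0 ≤ E := (hepos 0).le.trans (hEn 0)
  have hB0 : 0 ≤ E * C / c := by positivity
  have hbound : ∀ n i, |U n i| ≤ |R| + (E * C / c + 1) := by
    intro n i
    rcases le_total R |U n i| with h | h
    · have h₁ : (U n i ^ 2 - 1) * c ≤ E * C := by
        have := hR _ h
        have := hWle n i
        have := mul_le_mul_of_nonneg_right (hEn n) hC.le
        linarith
      have h₂ := (le_div_iff₀ hc).2 h₁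
      have h₃ : |U n i| ≤ E * C / c + 1 :=
        abs_le_of_sq_le_sq (by nlinarith) (by linarith)
      linarith [abs_nonneg R]
    · linarith [le_abs_self R]
  have hmem : ∀ n, U n ∈ Metric.closedBall (0 : Fin m → ℝ) (|R| + (E * C / c + 1)) := by
    intro n
    rw [mem_closedBall_zero_iff, pi_norm_le_iff_of_nonneg (by positivity)]
    exact hbound n
  obtain ⟨v, -, φ, hφ, hv⟩ := (isCompact_closedBall _ _).tendsto_subseq hmem
  refine ⟨φ, hφ, v, fun i => (hWzero _).1 (le_antisymm ?_ (hWnn _)), hv⟩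
  have h₁ : Tendsto (fun n => W (U (φ n) i)) atTop (𝓝 (W (v i))) :=
    (hW.tendsto _).comp (tendsto_pi_nhds.1 hv i)
  have h₂ : Tendsto (fun n => e (φ n) * C) atTop (𝓝 (0 * C)) :=
    (helim.comp hφ.tendsto_atTop).mul_const C
  rw [zero_mul] at h₂
  exact le_of_tendsto_of_tendsto' h₁ h₂ fun n => hWle _ i

lemma fidelity_nonneg (m : ℕ) (p : ℝ) (f u : Fin m → ℝ) : 0 ≤ fidelity m p f u :=
  Finset.sum_nonneg fun _ _ => Real.rpow_nonneg (abs_nonneg _) _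

lemma continuous_fidelity (m : ℕ) {p : ℝ} (hp : 0 < p) (f : Fin m → ℝ) :
    Continuous (fidelity m p f) :=
  continuous_finsetSum _ fun i _ =>
    Continuous.rpow_const (by fun_prop) fun _ => Or.inr hp.le

/-- Compatibility of the Γ-convergence `f_ε → f₀` with an `L^p` fidelity term and with a
mass constraint, together with the corresponding compactness statements. -/
theorem constraints_graphGL (m : ℕ) (ω : Fin m → Fin m → ℝ)
    (hωsymm : ∀ i j, ω i j = ω j i) (hωnn : ∀ i j, 0 ≤ ω i j) (hωdiag : ∀ i, ω i i = 0)
    (χ : ℝ) (hχ : 0 < χ)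
    (W : ℝ → ℝ) (hW : ContDiff ℝ 2 W) (hWnn : ∀ s, 0 ≤ W s)
    (hWzero : ∀ s, W s = 0 ↔ s = 0 ∨ s = 1)
    (p : ℝ) (hp : 0 < p) (lam : ℝ) (hlam : 0 < lam) (f : Fin m → ℝ)
    (e : ℕ → ℝ) (hepos : ∀ n, 0 < e n) (helim : Tendsto e atTop (nhds 0))
    (M : ℝ) (hM : 0 < M) (K : ℕ) (hK : K ≤ m) (hKM : (K : ℝ) = m * M) :
    -- Γ-convergence of `f_ε + λ|· - f|_p^p` to `f₀ + λ|· - f|_p^p`: (LB)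
    (∀ (u : Fin m → ℝ) (U : ℕ → Fin m → ℝ), Tendsto U atTop (nhds u) →
      graphGL0 m ω χ u + ENNReal.ofReal (lam * fidelity m p f u) ≤
        liminf (fun n =>
          ENNReal.ofReal (graphGL m ω χ W (e n) (U n) + lam * fidelity m p f (U n))) atTop) ∧
    -- (UB)
    (∀ u : Fin m → ℝ, ∃ U : ℕ → Fin m → ℝ, Tendsto U atTop (nhds u) ∧
      limsup (fun n =>
          ENNReal.ofReal (graphGL m ω χ W (e n) (U n) + lam * fidelity m p f (U n))) atTop ≤
        graphGL0 m ω χ u + ENNReal.ofReal (lam * fidelity m p f u)) ∧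
    -- Compactness for `f_ε + λ|· - f|_p^p` (assuming `(W2)`)
    ((∃ c > (0:ℝ), ∃ R : ℝ, ∀ s : ℝ, R ≤ |s| → c * (s ^ 2 - 1) ≤ W s) →
      ∀ (U : ℕ → Fin m → ℝ) (C : ℝ), 0 < C →
        (∀ n, graphGL m ω χ W (e n) (U n) + lam * fidelity m p f (U n) ≤ C) →
        ∃ φ : ℕ → ℕ, StrictMono φ ∧ ∃ uinf : Fin m → ℝ,
          (∀ i, uinf i = 0 ∨ uinf i = 1) ∧ Tendsto (U ∘ φ) atTop (nhds uinf)) ∧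
    -- Γ-convergence on the mass constrained set `V^M`: (LB)
    (∀ u : Fin m → ℝ, (∑ i, u i) = m * M →
      ∀ U : ℕ → Fin m → ℝ, (∀ n, (∑ i, U n i) = m * M) → Tendsto U atTop (nhds u) →
        graphGL0 m ω χ u ≤
          liminf (fun n => ENNReal.ofReal (graphGL m ω χ W (e n) (U n))) atTop) ∧
    -- (UB) on `V^M`
    (∀ u : Fin m → ℝ, (∑ i, u i) = m * M →
      ∃ U : ℕ → Fin m → ℝ, (∀ n, (∑ i, U n i) = m * M) ∧ Tendsto U atTop (nhds u) ∧
        limsup (fun n => ENNReal.ofReal (graphGL m ω χ W (e n) (U n))) atTop ≤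
          graphGL0 m ω χ u) ∧
    -- Compactness on `V^M` (assuming `(W2)`)
    ((∃ c > (0:ℝ), ∃ R : ℝ, ∀ s : ℝ, R ≤ |s| → c * (s ^ 2 - 1) ≤ W s) →
      ∀ (U : ℕ → Fin m → ℝ) (C : ℝ), 0 < C →
        (∀ n, (∑ i, U n i) = m * M) →
        (∀ n, graphGL m ω χ W (e n) (U n) ≤ C) →
        ∃ φ : ℕ → ℕ, StrictMono φ ∧ ∃ uinf : Fin m → ℝ,
          (∀ i, uinf i = 0 ∨ uinf i = 1) ∧ (∑ i, uinf i) = m * M ∧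
          Tendsto (U ∘ φ) atTop (nhds uinf)) := by
  have hWc : Continuous W := hW.continuous
  have hgc : Continuous fun u => lam * fidelity m p f u :=
    continuous_const.mul (continuous_fidelity m hp f)
  have hgnn : ∀ u, 0 ≤ lam * fidelity m p f u := fun u =>
    mul_nonneg hlam.le (fidelity_nonneg m p f u)
  refine ⟨fun u U hU => graphGL0_add_le_liminf hωnn hχ hWc hWnn hWzero hgc hgnn hepos helim hU,
    fun u => ⟨fun _ => u, tendsto_const_nhds,
      limsup_const_le_graphGL0_add ω hωnn hχ hWzero hgnn e u⟩,
    fun hW2 U C hC hUC => exists_subseq_tendsto_binary hωnn hχ hWc hWnn hWzero hepos helim hW2 hC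
      fun n => (le_add_of_nonneg_right (hgnn _)).trans (hUC n),
    fun u _ U _ hU => ?_, fun u hu => ⟨fun _ => u, fun _ => hu, tendsto_const_nhds, ?_⟩,
    fun hW2 U C hC hUM hUC => ?_⟩
  · simpa using graphGL0_add_le_liminf hωnn hχ hWc hWnn hWzero
      (g := fun _ => 0) continuous_const (fun _ => le_rfl) hepos helim hU
  · simpa using limsup_const_le_graphGL0_add ω hωnn hχ hWzero
      (g := fun _ => 0) (fun _ => le_rfl) e u
  · obtain ⟨φ, hφ, v, hvb, hv⟩ :=
      exists_subseq_tendsto_binary hωnn hχ hWc hWnn hWzero hepos helim hW2 hC hUC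
    refine ⟨φ, hφ, v, hvb, ?_, hv⟩
    have hsum : Tendsto (fun n => ∑ i, U (φ n) i) atTop (𝓝 (∑ i, v i)) :=
      tendsto_finsetSum _ fun i _ => tendsto_pi_nhds.1 hv i
    simp only [hUM] at hsum
    exact tendsto_nhds_unique hsum tendsto_const_nhds

end
end

section
/- Let u ∈ L¹(T²) and let u_n ∈ L¹(T²) and N_n ∈ ℕ be sequences such that u_n → u in L¹(T²) and N_n → ∞ as n → ∞. Then h_{∞,0}(u) ≤ liminf_{n→∞} h_{N_n,0}(u_n). -/
open MeasureTheory Filter Topology ENNReal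
open scoped Classical

noncomputable section

/-- Fundamental domain of the flat unit torus `T²`, identified with `[0,1)²`. -/
def Q2 : Set (ℝ × ℝ) := Set.Ico (0:ℝ) 1 ×ˢ Set.Ico (0:ℝ) 1

/-- Lebesgue measure on the torus, realized as Lebesgue measure on the fundamental domain. -/
def μT : Measure (ℝ × ℝ) := volume.restrict Q2

/-- A function on `ℝ²` represents a function on the torus `T²` iff it is `1`-periodic in
each coordinate. -/
def Periodic2 {E : Type*} (f : ℝ × ℝ → E) : Prop :=
  ∀ x : ℝ × ℝ, f (x.1 + 1, x.2) = f x ∧ f (x.1, x.2 + 1) = f x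

/-- The index of the grid square (of the `N × N` grid) a real number's fractional part lies in. -/
def gridIdx (N : ℕ) (t : ℝ) : ℕ := (⌊Int.fract t * N⌋).toNat

/-- The piecewise constant (on the squares `S_N^{i,j}`) extension of grid values `g` to the torus. -/
def extendGrid (N : ℕ) (g : ℕ → ℕ → ℝ) : ℝ × ℝ → ℝ :=
  fun x => g (gridIdx N x.1) (gridIdx N x.2)

/-- `g` represents `u ∈ A_N`: `u` agrees a.e. with the piecewise constant extension of `g`. -/
def RepGrid (N : ℕ) (u : ℝ × ℝ → ℝ) (g : ℕ → ℕ → ℝ) : Prop :=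
  u =ᵐ[μT] extendGrid N g

/-- Binary ({0,1}-valued) grid functions. -/
def IsBinaryGrid (N : ℕ) (g : ℕ → ℕ → ℝ) : Prop :=
  ∀ i < N, ∀ j < N, g i j = 0 ∨ g i j = 1

/-- Convergence in `L¹(T²)`. -/
def TendstoL1 (U : ℕ → ℝ × ℝ → ℝ) (u : ℝ × ℝ → ℝ) : Prop :=
  Tendsto (fun n => ∫⁻ x, ENNReal.ofReal |U n x - u x| ∂μT) atTop (nhds 0)

/-- The divergence of a vector field on `ℝ²`. -/
def div2 (v : ℝ × ℝ → ℝ × ℝ) (x : ℝ × ℝ) : ℝ :=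
  (fderiv ℝ v x (1, 0)).1 + (fderiv ℝ v x (0, 1)).2

/-- The (isotropic) total variation `∫_{T²} |∇u|` of `u ∈ L¹(T²)`, as supremum over `C¹`
periodic vector fields with Euclidean norm at most 1. -/
def isoTV (u : ℝ × ℝ → ℝ) : ℝ≥0∞ :=
  ⨆ (v : ℝ × ℝ → ℝ × ℝ) (_ : ContDiff ℝ 1 v ∧ Periodic2 v ∧
      ∀ x, (v x).1 ^ 2 + (v x).2 ^ 2 ≤ 1),
    ENNReal.ofReal (∫ x, u x * div2 v x ∂μT)

/-- The anisotropic total variation `∫_{T²} |u_x| + |u_y|`, as supremum over `C¹` periodic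
vector fields with max-norm at most 1. -/
def anisoTV (u : ℝ × ℝ → ℝ) : ℝ≥0∞ :=
  ⨆ (v : ℝ × ℝ → ℝ × ℝ) (_ : ContDiff ℝ 1 v ∧ Periodic2 v ∧
      ∀ x, |(v x).1| ≤ 1 ∧ |(v x).2| ≤ 1),
    ENNReal.ofReal (∫ x, u x * div2 v x ∂μT)

/-- `u ∈ BV(T²; {0,1})`: `u` takes values in `{0,1}` a.e. and has finite total variation. -/
def BV01 (u : ℝ × ℝ → ℝ) : Prop :=
  AEStronglyMeasurable u μT ∧ (∀ᵐ x ∂μT, u x = 0 ∨ u x = 1) ∧ isoTV u < ⊤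

/-- The grid cut energy of `h_{N,0}`. -/
def hEnergy (N : ℕ) (g : ℕ → ℕ → ℝ) : ℝ :=
  (N : ℝ)⁻¹ * ∑ i ∈ Finset.range N, ∑ j ∈ Finset.range N,
    (|g ((i + 1) % N) j - g i j| + |g i ((j + 1) % N) - g i j|)

/-- The functional `h_{N,0} : L¹(T²) → [0,∞]`. -/
def hN0 (N : ℕ) (u : ℝ × ℝ → ℝ) : ℝ≥0∞ :=
  ⨅ (g : ℕ → ℕ → ℝ) (_ : RepGrid N u g ∧ IsBinaryGrid N g), ENNReal.ofReal (hEnergy N g)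

/-- The limit functional `h_{∞,0}`: the anisotropic total variation on `BV(T²;{0,1})`,
`+∞` otherwise. -/
def hInf0 (u : ℝ × ℝ → ℝ) : ℝ≥0∞ := if BV01 u then anisoTV u else ⊤

theorem gridIdx_eq {N i : ℕ} (hi : i < N) {x : ℝ}
    (hx : x ∈ Set.Ico ((i : ℝ) / N) (((i + 1 : ℕ) : ℝ) / N)) : gridIdx N x = i := by
  have hN : (0 : ℝ) < N := by exact_mod_cast (Nat.zero_le i).trans_lt hi
  obtain ⟨h1, h2⟩ := hx
  have h1' := (div_le_iff₀ hN).1 h1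
  have h2' := (lt_div_iff₀ hN).1 h2
  have hx0 : 0 ≤ x := le_trans (by positivity) h1
  have hx1 : x < 1 := h2.trans_le ((div_le_one hN).2 (by exact_mod_cast hi))
  have hfl : ⌊x * N⌋ = (i : ℤ) := Int.floor_eq_iff.2 ⟨by exact_mod_cast h1', by exact_mod_cast h2'⟩
  simp [gridIdx, Int.fract_eq_self.2 ⟨hx0, hx1⟩, hfl]

theorem gridIdx_lt {N : ℕ} (hN : 0 < N) (x : ℝ) : gridIdx N x < N := by
  have hN' : (0 : ℝ) < N := by exact_mod_cast hN
  have h : ⌊Int.fract x * N⌋ < (N : ℤ) := by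
    rw [Int.floor_lt]
    have := mul_lt_mul_of_pos_right (Int.fract_lt_one x) hN'
    simpa using this
  unfold gridIdx
  omega

theorem measurable_gridIdx (N : ℕ) : Measurable (gridIdx N) := by
  unfold gridIdx
  exact (measurable_from_top (f := Int.toNat)).comp
    (Int.measurable_floor.comp (measurable_fract.mul_const _))

theorem measurable_extendGrid (N : ℕ) (g : ℕ → ℕ → ℝ) : Measurable (extendGrid N g) :=
  (Measurable.of_discrete (f := fun p : ℕ × ℕ => g p.1 p.2)).comp
    (((measurable_gridIdx N).comp measurable_fst).prodMk
      ((measurable_gridIdx N).comp measurable_snd))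

theorem integral_gridIdx_mul {N : ℕ} (hN : 0 < N) (G : ℕ → ℝ) {w : ℝ → ℝ} (hw : Continuous w) :
    ∫ x in Set.Ico (0 : ℝ) 1, G (gridIdx N x) * w x =
      ∑ i ∈ Finset.range N, G i * ∫ x in (i / N : ℝ)..((i + 1 : ℕ) / N : ℝ), w x := by
  have hN' : (0 : ℝ) < N := by exact_mod_cast hN
  have hle : ∀ i : ℕ, (i / N : ℝ) ≤ ((i + 1 : ℕ) / N : ℝ) := fun i => by
    gcongr; exact_mod_cast i.le_succ
  have hcongr : ∀ i < N, Set.EqOn (fun x => G i * w x) (fun x => G (gridIdx N x) * w x)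
      (Set.Ico (i / N : ℝ) ((i + 1 : ℕ) / N : ℝ)) := fun i hi x hx => by
    simp only [gridIdx_eq hi hx]
  have hint : ∀ i < N, IntervalIntegrable (fun x => G (gridIdx N x) * w x) volume
      (i / N : ℝ) ((i + 1 : ℕ) / N : ℝ) := fun i hi => by
    rw [intervalIntegrable_iff_integrableOn_Ico_of_le (hle i)]
    refine IntegrableOn.congr_fun ?_ (hcongr i hi) measurableSet_Ico
    exact ((hw.const_mul (G i)).integrableOn_Icc).mono_set Set.Ico_subset_Icc_self
  have hsum := intervalIntegral.sum_integral_adjacent_intervals (μ := volume)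
    (a := fun i : ℕ => (i / N : ℝ)) (n := N) hint
  rw [← integral_Icc_eq_integral_Ico, integral_Icc_eq_integral_Ioc,
    ← intervalIntegral.integral_of_le zero_le_one]
  have h01 : ((N : ℝ) / N) = 1 := div_self hN'.ne'
  simp only [Nat.cast_zero, zero_div, h01] at hsum
  rw [← hsum]
  refine Finset.sum_congr rfl fun i hi => ?_
  rw [← intervalIntegral.integral_const_mul, intervalIntegral.integral_of_le (hle i),
    intervalIntegral.integral_of_le (hle i), ← integral_Icc_eq_integral_Ioc,
    ← integral_Icc_eq_integral_Ioc, integral_Icc_eq_integral_Ico, integral_Icc_eq_integral_Ico]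
  exact (setIntegral_congr_fun measurableSet_Ico (hcongr i (Finset.mem_range.1 hi))).symm

theorem integral_gridIdx {N : ℕ} (hN : 0 < N) (G : ℕ → ℝ) :
    ∫ x in Set.Ico (0 : ℝ) 1, G (gridIdx N x) = (N : ℝ)⁻¹ * ∑ i ∈ Finset.range N, G i := by
  have h := integral_gridIdx_mul hN G (continuous_const (y := (1 : ℝ)))
  simp only [mul_one, intervalIntegral.integral_const, smul_eq_mul] at h
  rw [h, Finset.mul_sum]
  refine Finset.sum_congr rfl fun i _ => ?_
  push_cast
  ring

theorem sum_cyclic_mul_sub_le (N : ℕ) (G f : ℕ → ℝ) (hf : ∀ i, |f i| ≤ 1) (hper : f N = f 0) :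
    ∑ i ∈ Finset.range N, G i * (f (i + 1) - f i) ≤
      ∑ i ∈ Finset.range N, |G ((i + 1) % N) - G i| := by
  have hshift : ∑ i ∈ Finset.range N, G i * f i =
      ∑ i ∈ Finset.range N, G ((i + 1) % N) * f (i + 1) := by
    cases N with
    | zero => simp
    | succ M =>
      rw [Finset.sum_range_succ', Finset.sum_range_succ, Nat.mod_self, hper]
      congr 1
      refine Finset.sum_congr rfl fun i hi => ?_
      rw [Nat.mod_eq_of_lt (by have := Finset.mem_range.1 hi; omega)]
  calc ∑ i ∈ Finset.range N, G i * (f (i + 1) - f i)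
      = ∑ i ∈ Finset.range N, (G i - G ((i + 1) % N)) * f (i + 1) := by
        simp only [mul_sub, sub_mul, Finset.sum_sub_distrib, hshift]
    _ ≤ _ := Finset.sum_le_sum fun i _ => by
        calc _ ≤ |(G i - G ((i + 1) % N)) * f (i + 1)| := le_abs_self _
          _ ≤ |G i - G ((i + 1) % N)| := by
            rw [abs_mul]; exact mul_le_of_le_one_right (abs_nonneg _) (hf _)
          _ = _ := abs_sub_comm _ _

theorem integral_gridIdx_mul_deriv_le {N : ℕ} (hN : 0 < N) (G : ℕ → ℝ) {f f' : ℝ → ℝ}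
    (hf : ∀ x, HasDerivAt f (f' x) x) (hf' : Continuous f') (hb : ∀ x, |f x| ≤ 1)
    (hper : f 1 = f 0) :
    ∫ x in Set.Ico (0 : ℝ) 1, G (gridIdx N x) * f' x ≤
      ∑ i ∈ Finset.range N, |G ((i + 1) % N) - G i| := by
  rw [integral_gridIdx_mul hN G hf']
  have hN' : (N : ℝ) ≠ 0 := by exact_mod_cast hN.ne'
  refine le_of_eq_of_le (Finset.sum_congr rfl fun i _ => ?_)
    (sum_cyclic_mul_sub_le N G (fun i => f (i / N)) (fun i => hb _) (by simp [hN', hper]))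
  rw [intervalIntegral.integral_eq_sub_of_hasDerivAt (fun x _ => hf x)
    (hf'.intervalIntegrable _ _)]

theorem μT_eq_prod : μT = ((volume : Measure ℝ).restrict (Set.Ico 0 1)).prod
    ((volume : Measure ℝ).restrict (Set.Ico 0 1)) := by
  rw [Measure.prod_restrict]; rfl

theorem exists_abs_le_of_continuous {w : ℝ × ℝ → ℝ} (hw : Continuous w) :
    ∃ C, ∀ᵐ x ∂μT, |w x| ≤ C := by
  obtain ⟨C, hC⟩ := (isCompact_Icc (a := ((0, 0) : ℝ × ℝ)) (b := (1, 1))).exists_bound_of_continuousOn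
    hw.continuousOn
  refine ⟨C, ?_⟩
  filter_upwards [ae_restrict_mem (measurableSet_Ico.prod measurableSet_Ico)] with x hx
  exact hC x ⟨⟨hx.1.1, hx.2.1⟩, ⟨hx.1.2.le, hx.2.2.le⟩⟩

theorem integrable_mul_continuous {u w : ℝ × ℝ → ℝ} (hu : Integrable u μT) (hw : Continuous w) :
    Integrable (fun x => u x * w x) μT := by
  obtain ⟨C, hC⟩ := exists_abs_le_of_continuous hw
  exact hu.mul_bdd hw.aestronglyMeasurable hC

theorem continuous_fderiv_fst {v : ℝ × ℝ → ℝ × ℝ} (hv : ContDiff ℝ 1 v) (e : ℝ × ℝ) :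
    Continuous fun x => (fderiv ℝ v x e).1 :=
  continuous_fst.comp ((hv.continuous_fderiv one_ne_zero).clm_apply continuous_const)

theorem continuous_fderiv_snd {v : ℝ × ℝ → ℝ × ℝ} (hv : ContDiff ℝ 1 v) (e : ℝ × ℝ) :
    Continuous fun x => (fderiv ℝ v x e).2 :=
  continuous_snd.comp ((hv.continuous_fderiv one_ne_zero).clm_apply continuous_const)

theorem continuous_div2 {v : ℝ × ℝ → ℝ × ℝ} (hv : ContDiff ℝ 1 v) : Continuous (div2 v) :=
  (continuous_fderiv_fst hv _).add (continuous_fderiv_snd hv _)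

theorem hasDerivAt_left {v : ℝ × ℝ → ℝ × ℝ} (hv : ContDiff ℝ 1 v) (x y : ℝ) :
    HasDerivAt (fun t => (v (t, y)).1) (fderiv ℝ v (x, y) (1, 0)).1 x := by
  have h := ((hv.differentiable one_ne_zero) (x, y)).hasFDerivAt.comp_hasDerivAt x
    ((hasDerivAt_id x).prodMk (hasDerivAt_const x y))
  exact (ContinuousLinearMap.fst ℝ ℝ ℝ).hasFDerivAt.comp_hasDerivAt x h

theorem hasDerivAt_right {v : ℝ × ℝ → ℝ × ℝ} (hv : ContDiff ℝ 1 v) (x y : ℝ) :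
    HasDerivAt (fun t => (v (x, t)).2) (fderiv ℝ v (x, y) (0, 1)).2 y := by
  have h := ((hv.differentiable one_ne_zero) (x, y)).hasFDerivAt.comp_hasDerivAt y
    ((hasDerivAt_const y x).prodMk (hasDerivAt_id y))
  exact (ContinuousLinearMap.snd ℝ ℝ ℝ).hasFDerivAt.comp_hasDerivAt y h

theorem integrable_gridIdx {N : ℕ} (hN : 0 < N) (G : ℕ → ℝ) :
    Integrable (fun x => G (gridIdx N x)) ((volume : Measure ℝ).restrict (Set.Ico 0 1)) := by
  refine Integrable.of_bound
    ((Measurable.of_discrete (f := G)).comp (measurable_gridIdx N)).aestronglyMeasurable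
    (∑ i ∈ Finset.range N, |G i|) (.of_forall fun x => ?_)
  exact Finset.single_le_sum (f := fun i => |G i|) (fun i _ => abs_nonneg _)
    (Finset.mem_range.2 (gridIdx_lt hN x))

theorem integral_mul_div2_le_hEnergy {N : ℕ} (hN : 0 < N) {U : ℝ × ℝ → ℝ} (hU : Integrable U μT)
    {g : ℕ → ℕ → ℝ} (hg : RepGrid N U g) {v : ℝ × ℝ → ℝ × ℝ} (hv : ContDiff ℝ 1 v)
    (hper : Periodic2 v) (hb : ∀ x, |(v x).1| ≤ 1 ∧ |(v x).2| ≤ 1) :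
    ∫ x, U x * div2 v x ∂μT ≤ hEnergy N g := by
  have hE : Integrable (extendGrid N g) μT := hU.congr hg
  have h1 := integrable_mul_continuous hE (continuous_fderiv_fst hv (1, 0))
  have h2 := integrable_mul_continuous hE (continuous_fderiv_snd hv (0, 1))
  have hsplit : ∫ x, U x * div2 v x ∂μT =
      (∫ x, extendGrid N g x * (fderiv ℝ v x (1, 0)).1 ∂μT) +
        ∫ x, extendGrid N g x * (fderiv ℝ v x (0, 1)).2 ∂μT := by
    rw [← integral_add h1 h2]
    refine integral_congr_ae ?_
    filter_upwards [hg] with x hx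
    simp only [hx, div2, mul_add]
  rw [μT_eq_prod] at h1 h2
  have hx : ∫ x, extendGrid N g x * (fderiv ℝ v x (1, 0)).1 ∂μT ≤
      (N : ℝ)⁻¹ * ∑ j ∈ Finset.range N, ∑ i ∈ Finset.range N, |g ((i + 1) % N) j - g i j| := by
    rw [μT_eq_prod, integral_prod_symm _ h1, ← integral_gridIdx hN]
    refine integral_mono h1.integral_prod_right (integrable_gridIdx hN
      fun j => ∑ i ∈ Finset.range N, |g ((i + 1) % N) j - g i j|) fun y => ?_
    exact integral_gridIdx_mul_deriv_le hN (fun i => g i (gridIdx N y))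
      (f := fun t => (v (t, y)).1) (f' := fun t => (fderiv ℝ v (t, y) (1, 0)).1)
      (fun x => hasDerivAt_left hv x y)
      ((continuous_fderiv_fst hv (1, 0)).comp (Continuous.prodMk_left y))
      (fun x => (hb _).1) (by simpa using congrArg Prod.fst (hper (0, y)).1)
  have hy : ∫ x, extendGrid N g x * (fderiv ℝ v x (0, 1)).2 ∂μT ≤
      (N : ℝ)⁻¹ * ∑ i ∈ Finset.range N, ∑ j ∈ Finset.range N, |g i ((j + 1) % N) - g i j| := by
    rw [μT_eq_prod, integral_prod _ h2, ← integral_gridIdx hN]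
    refine integral_mono h2.integral_prod_left (integrable_gridIdx hN
      fun i => ∑ j ∈ Finset.range N, |g i ((j + 1) % N) - g i j|) fun x => ?_
    exact integral_gridIdx_mul_deriv_le hN (fun j => g (gridIdx N x) j)
      (f := fun t => (v (x, t)).2) (f' := fun t => (fderiv ℝ v (x, t) (0, 1)).2)
      (fun y => hasDerivAt_right hv x y)
      ((continuous_fderiv_snd hv (0, 1)).comp (Continuous.prodMk_right x))
      (fun y => (hb _).2) (by simpa using congrArg Prod.snd (hper (x, 0)).2)
  rw [hsplit, hEnergy]
  rw [Finset.sum_comm] at hx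
  simp only [Finset.sum_add_distrib, mul_add]
  exact add_le_add hx hy

theorem anisoTV_le_hN0 {N : ℕ} (hN : 0 < N) {U : ℝ × ℝ → ℝ} (hU : Integrable U μT) :
    anisoTV U ≤ hN0 N U :=
  iSup₂_le fun _ hv => le_iInf₂ fun _ hg => ENNReal.ofReal_le_ofReal
    (integral_mul_div2_le_hEnergy hN hU hg.1 hv.1 hv.2.1 hv.2.2)

theorem TendstoL1.tendsto_integral_mul {u : ℝ × ℝ → ℝ} {U : ℕ → ℝ × ℝ → ℝ} (hconv : TendstoL1 U u)
    (hu : Integrable u μT) (hU : ∀ n, Integrable (U n) μT) {w : ℝ × ℝ → ℝ} (hw : Continuous w) :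
    Tendsto (fun n => ∫ x, U n x * w x ∂μT) atTop (𝓝 (∫ x, u x * w x ∂μT)) := by
  obtain ⟨C, hC⟩ := exists_abs_le_of_continuous hw
  refine tendsto_integral_of_L1 _ (integrable_mul_continuous hu hw).aestronglyMeasurable
    (.of_forall fun n => integrable_mul_continuous (hU n) hw) ?_
  have hlim := ENNReal.Tendsto.const_mul (a := ENNReal.ofReal C) hconv (.inr ENNReal.ofReal_ne_top)
  rw [mul_zero] at hlim
  refine tendsto_of_tendsto_of_tendsto_of_le_of_le tendsto_const_nhds hlim
    (fun _ => zero_le) fun n => ?_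
  rw [← lintegral_const_mul' _ _ ENNReal.ofReal_ne_top]
  refine lintegral_mono_ae ?_
  filter_upwards [hC] with x hx
  rw [← ENNReal.ofReal_mul ((abs_nonneg _).trans hx), ← ofReal_norm, ← sub_mul,
    Real.norm_eq_abs, abs_mul, mul_comm]
  gcongr

theorem TendstoL1.anisoTV_le_liminf {u : ℝ × ℝ → ℝ} {U : ℕ → ℝ × ℝ → ℝ} (hconv : TendstoL1 U u)
    (hu : Integrable u μT) (hU : ∀ n, Integrable (U n) μT) :
    anisoTV u ≤ liminf (fun n => anisoTV (U n)) atTop := by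
  refine iSup₂_le fun v hv => ?_
  rw [← (ENNReal.tendsto_ofReal
    (hconv.tendsto_integral_mul hu hU (continuous_div2 hv.1))).liminf_eq]
  exact liminf_le_liminf (.of_forall fun n => le_iSup₂_of_le v hv le_rfl)

theorem isoTV_le_anisoTV (u : ℝ × ℝ → ℝ) : isoTV u ≤ anisoTV u :=
  iSup₂_le fun v hv => le_iSup₂_of_le v ⟨hv.1, hv.2.1, fun x =>
    ⟨(sq_le_one_iff_abs_le_one _).1 (by nlinarith [hv.2.2 x, sq_nonneg (v x).2]),
      (sq_le_one_iff_abs_le_one _).1 (by nlinarith [hv.2.2 x, sq_nonneg (v x).1])⟩⟩ le_rfl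

theorem ae_zero_or_one_of_hN0_lt_top {N : ℕ} (hN : 0 < N) {U : ℝ × ℝ → ℝ} (h : hN0 N U < ⊤) :
    ∀ᵐ x ∂μT, U x = 0 ∨ U x = 1 := by
  obtain ⟨g, hg⟩ := iInf_lt_iff.1 h
  obtain ⟨⟨hrep, hbin⟩, -⟩ := iInf_lt_iff.1 hg
  filter_upwards [hrep] with x hx
  rw [hx]
  exact hbin _ (gridIdx_lt hN _) _ (gridIdx_lt hN _)

theorem TendstoL1.ae_zero_or_one {u : ℝ × ℝ → ℝ} {U : ℕ → ℝ × ℝ → ℝ} (hconv : TendstoL1 U u)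
    (hu : AEStronglyMeasurable u μT)
    (hfreq : ∃ᶠ n in atTop, ∀ᵐ x ∂μT, U n x = 0 ∨ U n x = 1) :
    ∀ᵐ x ∂μT, u x = 0 ∨ u x = 1 := by
  have hle : ∫⁻ x, ENNReal.ofReal (min |u x| |1 - u x|) ∂μT ≤ 0 := by
    refine ge_of_tendsto_of_frequently hconv (hfreq.mono fun n hn => lintegral_mono_ae ?_)
    filter_upwards [hn] with x hx
    refine ENNReal.ofReal_le_ofReal ?_
    rcases hx with hx | hx <;> simp [hx]
  have hm : AEMeasurable (fun x => ENNReal.ofReal (min |u x| |1 - u x|)) μT := by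
    have := hu.aemeasurable
    fun_prop
  filter_upwards [(lintegral_eq_zero_iff' hm).1 (le_antisymm hle zero_le)] with x hx
  have hx' := ENNReal.ofReal_eq_zero.1 hx
  rcases min_le_iff.1 hx' with h | h
  · exact .inl (abs_nonpos_iff.1 h)
  · exact .inr (sub_eq_zero.1 (abs_nonpos_iff.1 h)).symm

/-- Lower bound (LB) for the Γ-convergence `h_{N,0} → h_{∞,0}`: if `u_n → u` in `L¹(T²)` and
`N_n → ∞`, then `h_{∞,0}(u) ≤ liminf_n h_{N_n,0}(u_n)`. -/
theorem lower_bound_hN0 (u : ℝ × ℝ → ℝ) (hu : Integrable u μT)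
    (U : ℕ → ℝ × ℝ → ℝ) (hU : ∀ n, Integrable (U n) μT)
    (Nn : ℕ → ℕ) (hNn : Tendsto Nn atTop atTop) (hconv : TendstoL1 U u) :
    hInf0 u ≤ liminf (fun n => hN0 (Nn n) (U n)) atTop := by
  have hle : anisoTV u ≤ liminf (fun n => hN0 (Nn n) (U n)) atTop :=
    (hconv.anisoTV_le_liminf hu hU).trans (liminf_le_liminf
      ((hNn.eventually_gt_atTop 0).mono fun n hn => anisoTV_le_hN0 hn (hU n)))
  rcases eq_or_ne (liminf (fun n => hN0 (Nn n) (U n)) atTop) ⊤ with htop | htop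
  · rw [htop]
    exact le_top
  have hfreq := (frequently_lt_of_liminf_lt (h := htop.lt_top)).and_eventually
    (hNn.eventually_gt_atTop 0)
  have hBV : BV01 u := ⟨hu.aestronglyMeasurable,
    hconv.ae_zero_or_one hu.aestronglyMeasurable
      (hfreq.mono fun n hn => ae_zero_or_one_of_hN0_lt_top hn.2 hn.1),
    (isoTV_le_anisoTV u).trans_lt (hle.trans_lt htop.lt_top)⟩
  rwa [hInf0, if_pos hBV]

end
end
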